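/- arXiv:2605.10617 — 5 statements merged into one kernel-verified Lean document; each statement's English description precedes it below -/
import Mathlib

section
/- Let s > 0 and t ∈ (0, 1/s). Then log_N(N · x_{1/N}(t · log N)) → s·t as N → ∞ (N ranging over the naturals with N ≥ 2), where x_{1/N}(u) = 1/(1 + e^{−su}(N − 1)). -/
open Filter

/-- For `s > 0` and `t ∈ (0, 1/s)`, with `x_{1/N}(u) = 1/(1 + e^{-su}(N-1))`,
one has `log_N (N · x_{1/N}(t log N)) → s·t` as `N → ∞`. -/
theorem stmt_1 (s t : ℝ) (hs : 0 < s) (ht : t ∈ Set.Ioo (0 : ℝ) (1 / s)) :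
    Tendsto
      (fun N : ℕ =>
        Real.log ((N : ℝ) * (1 / (1 + Real.exp (-s * (t * Real.log N)) * ((N : ℝ) - 1)))) /
          Real.log N)
      atTop (nhds (s * t)) := by
  have ha0 : 0 < s * t := mul_pos hs ht.1
  have ha1 : s * t < 1 := by
    have := ht.2
    rw [lt_div_iff₀ hs] at this
    linarith
  have hL : Tendsto (fun N : ℕ => Real.log (N : ℝ)) atTop atTop :=
    Real.tendsto_log_atTop.comp tendsto_natCast_atTop_atTop
  have hlow : Tendsto (fun N : ℕ => s * t - Real.log 2 / Real.log (N : ℝ)) atTop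
      (nhds (s * t)) := by
    simpa using (tendsto_const_nhds (x := s * t)).sub (hL.const_div_atTop (Real.log 2))
  have key : ∀ N : ℕ, 2 ≤ N → s * t - Real.log 2 / Real.log (N : ℝ) ≤
      Real.log ((N : ℝ) * (1 / (1 + Real.exp (-s * (t * Real.log N)) * ((N : ℝ) - 1)))) /
          Real.log N ∧
      Real.log ((N : ℝ) * (1 / (1 + Real.exp (-s * (t * Real.log N)) * ((N : ℝ) - 1)))) /
          Real.log N ≤ s * t := by
    intro N hN
    have hN2 : (2 : ℝ) ≤ N := by exact_mod_cast hN
    have hNpos : (0 : ℝ) < N := by linarith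
    have hLpos : 0 < Real.log (N : ℝ) := Real.log_pos (by linarith)
    set L := Real.log (N : ℝ) with hLdef
    have hNe : (N : ℝ) = Real.exp L := (Real.exp_log hNpos).symm
    have hE : Real.exp (-s * (t * L)) * N = Real.exp ((1 - s * t) * L) := by
      rw [hNe, ← Real.exp_add]; congr 1; ring
    have hE1 : Real.exp (-s * (t * L)) ≤ 1 := by
      apply Real.exp_le_one_iff.2
      nlinarith [mul_pos ha0 hLpos]
    have hE2 : 1 ≤ Real.exp ((1 - s * t) * L) := by
      apply Real.one_le_exp
      exact mul_nonneg (by linarith) hLpos.le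
    have hE0 := Real.exp_pos (-s * (t * L))
    set D := 1 + Real.exp (-s * (t * L)) * ((N : ℝ) - 1) with hD
    have h1 : Real.exp ((1 - s * t) * L) ≤ D := by rw [← hE, hD]; linarith
    have h2 : D ≤ 2 * Real.exp ((1 - s * t) * L) := by
      have : D = 1 + Real.exp ((1 - s * t) * L) - Real.exp (-s * (t * L)) := by
        rw [← hE, hD]; ring
      linarith
    have hDpos : 0 < D := by linarith
    have l1 : (1 - s * t) * L ≤ Real.log D := by
      rwa [Real.le_log_iff_exp_le hDpos]
    have l2 : Real.log D ≤ Real.log 2 + (1 - s * t) * L := by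
      have := Real.log_le_log hDpos h2
      rwa [Real.log_mul (by norm_num) (Real.exp_pos _).ne', Real.log_exp] at this
    have e : Real.log ((N : ℝ) * (1 / D)) = L - Real.log D := by
      rw [mul_one_div, Real.log_div hNpos.ne' hDpos.ne']
    rw [e]
    constructor
    · rw [le_div_iff₀ hLpos, sub_mul, div_mul_cancel₀ _ hLpos.ne']
      linarith
    · rw [div_le_iff₀ hLpos]
      linarith
  refine tendsto_of_tendsto_of_tendsto_of_le_of_le' hlow tendsto_const_nhds ?_ ?_
  · filter_upwards [eventually_ge_atTop 2] with N hN using (key N hN).1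
  · filter_upwards [eventually_ge_atTop 2] with N hN using (key N hN).2
end

section
/- For every real r ∈ (0,1) and every integer k ≥ 1, one has (1/2)·(k+1)/k ≤ (1 − r^{k+1}) / ((1+r)(1 − r^k)), and the inequality is strict whenever k ≥ 2. Equivalently, for k ≥ 2 the polynomial f(r) := −(k−1) r^{k+1} + (k+1) r^k − (k+1) r + (k−1) is strictly positive on (0,1). -/
theorem aux_g (r : ℝ) (h0 : 0 < r) (h1 : r < 1) (k : ℕ) :
    0 < r ^ (k + 2) - ((k : ℝ) + 2) * r + ((k : ℝ) + 1) := by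
  induction k with
  | zero => norm_num; nlinarith [mul_pos (sub_pos.2 h1) (sub_pos.2 h1)]
  | succ n ih =>
    have hp : r ^ (n + 2) < 1 := pow_lt_one₀ h0.le h1 (by omega)
    have := mul_pos (sub_pos.2 h1) (sub_pos.2 hp)
    push_cast
    have e : r ^ (n + 1 + 2) = r ^ (n + 2) * r := by ring
    rw [e]
    nlinarith

theorem aux_f (r : ℝ) (h0 : 0 < r) (h1 : r < 1) (k : ℕ) :
    0 < -((k : ℝ) + 1) * r ^ (k + 3) + ((k : ℝ) + 3) * r ^ (k + 2)
      - ((k : ℝ) + 3) * r + ((k : ℝ) + 1) := by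
  induction k with
  | zero =>
    have := pow_pos (sub_pos.2 h1) 3
    norm_num
    nlinarith
  | succ n ih =>
    have a := mul_pos (sub_pos.2 h1) (aux_g r h0 h1 (n + 1))
    have b := mul_pos h0 ih
    push_cast at a ⊢
    have := add_pos a b
    ring_nf at this ⊢
    linarith

/-- For `r ∈ (0,1)` and integers `k ≥ 1`:
`(1/2)·(k+1)/k ≤ (1 - r^{k+1}) / ((1+r)(1 - r^k))`, strictly for `k ≥ 2`;
equivalently, for `k ≥ 2` the polynomial
`f(r) = -(k-1) r^{k+1} + (k+1) r^k - (k+1) r + (k-1)` is strictly positive on `(0,1)`. -/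
theorem stmt_4 (r : ℝ) (hr : r ∈ Set.Ioo (0 : ℝ) 1) (k : ℕ) (hk : 1 ≤ k) :
    (1 / 2 : ℝ) * ((k : ℝ) + 1) / k ≤ (1 - r ^ (k + 1)) / ((1 + r) * (1 - r ^ k)) ∧
      (2 ≤ k →
        ((1 / 2 : ℝ) * ((k : ℝ) + 1) / k < (1 - r ^ (k + 1)) / ((1 + r) * (1 - r ^ k)) ∧
          0 < -((k : ℝ) - 1) * r ^ (k + 1) + ((k : ℝ) + 1) * r ^ k
              - ((k : ℝ) + 1) * r + ((k : ℝ) - 1))) := by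
  obtain ⟨h0, h1⟩ := hr
  have hk0 : (0 : ℝ) < k := by exact_mod_cast hk
  have hp : r ^ k < 1 := pow_lt_one₀ h0.le h1 (by omega)
  have hd : 0 < (1 + r) * (1 - r ^ k) := mul_pos (by linarith) (by linarith)
  have hf : 2 ≤ k → 0 < -((k : ℝ) - 1) * r ^ (k + 1) + ((k : ℝ) + 1) * r ^ k
              - ((k : ℝ) + 1) * r + ((k : ℝ) - 1) := by
    intro h2
    obtain ⟨n, rfl⟩ := Nat.exists_eq_add_of_le' h2
    have := aux_f r h0 h1 n
    push_cast
    ring_nf at this ⊢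
    linarith
  have hs : 2 ≤ k → (1 / 2 : ℝ) * ((k : ℝ) + 1) / k
      < (1 - r ^ (k + 1)) / ((1 + r) * (1 - r ^ k)) := by
    intro h2
    have := hf h2
    rw [div_lt_div_iff₀ hk0 hd]
    ring_nf at this ⊢
    linarith
  refine ⟨?_, fun h2 => ⟨hs h2, hf h2⟩⟩
  rcases Nat.lt_or_ge k 2 with h | h
  · obtain rfl : k = 1 := by omega
    rw [div_le_div_iff₀ hk0 hd]
    norm_num
    apply le_of_eq
    ring
  · exact (hs h).le
end

section
/- Let W* be the Bessel-like Markov chain started at 0 (transition from 0 to 1 with probability 1; from k ≥ 1 up to k+1 with probability (k+1)/(2k) and down to k−1 with probability (k−1)/(2k)), and assume the almost-sure asymptotics limsup_{n→∞} W*(n)/√(2 n log log n) = 1 and liminf_{n→∞} (log n)² W*(n)/√(2n) = ∞. Then (all hitting times τ_k being almost surely finite) max_{1 ≤ k ≤ N} max_{τ_k ≤ n < τ_{k+1}} ( log_N k − log_N W*(n) ) → 0 almost surely as N → ∞. -/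
open MeasureTheory ProbabilityTheory Filter Set

/-- One-step upward transition probability of the Bessel-like chain `W*_{1/2}`:
from `0` it moves to `1` with probability `1`, from `k ≥ 1` it moves up with
probability `(k+1)/(2k)`. -/
noncomputable def besselUp (k : ℕ) : ℝ :=
  if k = 0 then 1 else ((k : ℝ) + 1) / (2 * k)

/-- First hitting time of level `m` by the chain `n ↦ V n ω`, `⊤` if never hit. -/
noncomputable def hitTimeN {Ω : Type} (V : ℕ → Ω → ℕ) (m : ℕ) (ω : Ω) : ℕ∞ :=
  ⨅ (n : ℕ) (_ : V n ω = m), (n : ℕ∞)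

theorem aux_det (a : ℕ → ℕ)
    (hls : Filter.limsup
        (fun n : ℕ => (a n : ℝ) / Real.sqrt (2 * n * Real.log (Real.log n))) atTop = 1)
    (hli : Tendsto (fun n : ℕ => (Real.log n) ^ 2 * (a n : ℝ) / Real.sqrt (2 * n))
        atTop atTop) (δ : ℝ) (hδ : 0 < δ) :
    ∃ n1 : ℕ, ∀ j ≥ n1, Real.log (a j) ≤ (1/2 + δ) * Real.log j ∧
      (1/2 - δ) * Real.log j ≤ Real.log (a j) ∧ 0 ≤ Real.log (j : ℝ) := by
  have hb : IsBoundedUnder (· ≤ ·) atTop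
      (fun n : ℕ => (a n : ℝ) / Real.sqrt (2 * n * Real.log (Real.log n))) := by
    by_contra hb
    have he : {c : ℝ | ∀ᶠ n : ℕ in atTop,
        (a n : ℝ) / Real.sqrt (2 * n * Real.log (Real.log n)) ≤ c} = ∅ := by
      ext c
      simp only [Set.mem_ofPred_eq, Set.mem_empty_iff_false, iff_false]
      intro hc
      exact hb ⟨c, by simpa using hc⟩
    rw [Filter.limsup_eq, he, Real.sInf_empty] at hls
    norm_num at hls
  have h2 := Filter.eventually_lt_of_limsup_lt
    (show Filter.limsup (fun n : ℕ =>
      (a n : ℝ) / Real.sqrt (2 * n * Real.log (Real.log n))) atTop < 2 by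
        rw [hls]; norm_num) hb
  have h1 := hli.eventually_ge_atTop 1
  have hlog : Tendsto (fun n : ℕ => Real.log (n : ℝ)) atTop atTop :=
    Real.tendsto_log_atTop.comp tendsto_natCast_atTop_atTop
  have h3 : ∀ᶠ x : ℝ in atTop, Real.log x ≤ (δ / 4) * x := by
    have := Real.isLittleO_log_id_atTop.bound (show 0 < δ / 4 by positivity)
    filter_upwards [this, eventually_ge_atTop 1] with x hx hx1
    have hl := Real.log_nonneg hx1
    simpa [abs_of_nonneg hl, abs_of_nonneg (show 0 ≤ x by linarith)] using hx
  have h3' := hlog.eventually h3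
  have h4 := hlog.eventually_ge_atTop (max 3 (8 / δ))
  obtain ⟨n1, hn1⟩ := eventually_atTop.1 (h1.and (h2.and (h3'.and (h4.and (eventually_ge_atTop 1)))))
  refine ⟨n1, fun j hj => ?_⟩
  obtain ⟨k1, k2, k3, k4, k5⟩ := hn1 j hj
  have hj0 : (0 : ℝ) < j := by exact_mod_cast k5
  have hx3 : 3 ≤ Real.log (j : ℝ) := le_trans (le_max_left _ _) k4
  have hx8 : 8 ≤ Real.log (j : ℝ) * δ := by
    have := le_trans (le_max_right _ _) k4
    rwa [div_le_iff₀ hδ] at this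
  set x := Real.log (j : ℝ) with hx
  have hL : 0 < Real.log x := Real.log_pos (by linarith)
  have hs : 0 < Real.sqrt (2 * j) := Real.sqrt_pos.2 (by positivity)
  have hs' : 0 < Real.sqrt (2 * j * Real.log x) := Real.sqrt_pos.2 (by positivity)
  have ha : (0 : ℝ) < a j := by
    rcases Nat.eq_zero_or_pos (a j) with h | h
    · rw [h] at k1; norm_num at k1
    · exact_mod_cast h
  rw [le_div_iff₀ hs, one_mul] at k1
  rw [div_lt_iff₀ hs'] at k2
  have e1 := Real.log_le_log hs k1
  have e2 := Real.log_le_log ha k2.le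
  have hx0 : 0 < x := by linarith
  rw [Real.log_sqrt (by positivity), Real.log_mul (by norm_num) hj0.ne',
    Real.log_mul (by positivity) ha.ne', Real.log_pow] at e1
  rw [Real.log_mul (by norm_num) hs'.ne', Real.log_sqrt (by positivity),
    Real.log_mul (by positivity) hL.ne', Real.log_mul (by norm_num) hj0.ne'] at e2
  have e3 := Real.log_le_sub_one_of_pos hL
  have e4 := Real.log_two_lt_d9
  have e5 := Real.log_two_gt_d9
  push_cast at e1
  refine ⟨?_, ?_, hx0.le⟩ <;> nlinarith

theorem aux_hit {Ω : Type} (V : ℕ → Ω → ℕ) (k n : ℕ) (ω : Ω)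
    (h : hitTimeN V k ω ≤ (n : ℕ∞)) : ∃ j ≤ n, V j ω = k := by
  by_contra hc
  push Not at hc
  have : ((n + 1 : ℕ) : ℕ∞) ≤ hitTimeN V k ω := by
    refine le_iInf₂ fun j hj => ?_
    have : n < j := by
      by_contra h'
      exact hc j (by omega) hj
    exact_mod_cast this
  have := this.trans h
  have : n + 1 ≤ n := by exact_mod_cast this
  omega

theorem aux_step
    (Ω : Type) [MeasurableSpace Ω] (μ : Measure Ω) [IsProbabilityMeasure μ]
    (V : ℕ → Ω → ℕ) (hmeas : ∀ n, Measurable (V n))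
    (hupstep : ∀ (n : ℕ) (v : ℕ → ℕ),
      μ ({ω | ∀ j ≤ n, V j ω = v j} ∩ {ω | V (n + 1) ω = v n + 1}) =
        ENNReal.ofReal (besselUp (v n)) * μ {ω | ∀ j ≤ n, V j ω = v j})
    (hdownstep : ∀ (n : ℕ) (v : ℕ → ℕ),
      μ ({ω | ∀ j ≤ n, V j ω = v j} ∩ {ω | V (n + 1) ω = v n - 1}) =
        ENNReal.ofReal (1 - besselUp (v n)) * μ {ω | ∀ j ≤ n, V j ω = v j}) (n : ℕ) :
    ∀ᵐ ω ∂μ, V (n + 1) ω ≤ V n ω + 1 := by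
  have key : ∀ v : ℕ → ℕ, ∀ᵐ ω ∂μ, (∀ j ≤ n, V j ω = v j) → V (n + 1) ω ≤ V n ω + 1 := by
    intro v
    set C := {ω | ∀ j ≤ n, V j ω = v j} with hC
    have mC : MeasurableSet C := by
      have : C = ⋂ j, ⋂ (_ : j ≤ n), V j ⁻¹' {v j} := by
        ext ω; simp [hC]
      rw [this]
      exact MeasurableSet.iInter fun j => MeasurableSet.iInter fun _ =>
        hmeas j (measurableSet_singleton _)
    have mU : MeasurableSet {ω | V (n + 1) ω = v n + 1} :=
      hmeas (n+1) (measurableSet_singleton (v n + 1))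
    have mD : MeasurableSet {ω | V (n + 1) ω = v n - 1} :=
      hmeas (n+1) (measurableSet_singleton (v n - 1))
    set A := C ∩ {ω | V (n + 1) ω = v n + 1} with hA
    set B := C ∩ {ω | V (n + 1) ω = v n - 1} with hB
    have hd : Disjoint A B := by
      rw [Set.disjoint_left]
      rintro ω ⟨_, h1⟩ ⟨_, h2⟩
      simp only [Set.mem_ofPred_eq] at h1 h2
      omega
    have hb0 : 0 ≤ besselUp (v n) := by
      unfold besselUp; split_ifs <;> positivity
    have hb1 : besselUp (v n) ≤ 1 := by
      unfold besselUp
      split_ifs with h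
      · exact le_rfl
      · have : (1 : ℝ) ≤ v n := by exact_mod_cast Nat.one_le_iff_ne_zero.2 h
        rw [div_le_one (by positivity)]
        linarith
    have hsum : μ (A ∪ B) = μ C := by
      rw [measure_union hd (mC.inter mD), hupstep n v, hdownstep n v, ← add_mul,
        ← ENNReal.ofReal_add hb0 (by linarith)]
      simp [hC]
    have hz : μ (C \ (A ∪ B)) = 0 := by
      rw [measure_sdiff (by
        rintro ω (h | h)
        · exact h.1
        · exact h.1) ((mC.inter mU).union (mC.inter mD)).nullMeasurableSet
          (measure_ne_top _ _), hsum, tsub_self]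
    have := measure_eq_zero_iff_ae_notMem.1 hz
    filter_upwards [this] with ω hω hCω
    by_contra hcon
    apply hω
    refine ⟨hCω, ?_⟩
    have hn := hCω n le_rfl
    rintro (h | h)
    · have := h.2
      simp only [Set.mem_ofPred_eq] at this
      omega
    · have := h.2
      simp only [Set.mem_ofPred_eq] at this
      omega
  have key2 : ∀ᵐ ω ∂μ, ∀ w : Fin (n + 1) → ℕ,
      (∀ j ≤ n, V j ω = (if h : j < n + 1 then w ⟨j, h⟩ else 0)) →
        V (n + 1) ω ≤ V n ω + 1 := by
    rw [ae_all_iff]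
    intro w
    exact key (fun j => if h : j < n + 1 then w ⟨j, h⟩ else 0)
  filter_upwards [key2] with ω hω
  refine hω (fun i => V i ω) ?_
  intro j hj
  simp [Nat.lt_succ_of_le hj]

/-- For the Bessel-like chain `W*` started at `0`, assuming the almost sure asymptotics
`limsup W*(n)/√(2n log log n) = 1` and `(log n)² W*(n)/√(2n) → ∞`, all hitting times are
almost surely finite and
`max_{1 ≤ k ≤ N} max_{τ_k ≤ n < τ_{k+1}} (log_N k - log_N W*(n)) → 0` almost surely. -/
theorem stmt_14
    (Ω : Type) [MeasurableSpace Ω] (μ : Measure Ω) [IsProbabilityMeasure μ]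
    (V : ℕ → Ω → ℕ) (hmeas : ∀ n, Measurable (V n))
    (hstart : μ {ω | V 0 ω = 0} = 1)
    (hupstep : ∀ (n : ℕ) (v : ℕ → ℕ),
      μ ({ω | ∀ j ≤ n, V j ω = v j} ∩ {ω | V (n + 1) ω = v n + 1}) =
        ENNReal.ofReal (besselUp (v n)) * μ {ω | ∀ j ≤ n, V j ω = v j})
    (hdownstep : ∀ (n : ℕ) (v : ℕ → ℕ),
      μ ({ω | ∀ j ≤ n, V j ω = v j} ∩ {ω | V (n + 1) ω = v n - 1}) =
        ENNReal.ofReal (1 - besselUp (v n)) * μ {ω | ∀ j ≤ n, V j ω = v j})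
    (hlimsup : ∀ᵐ ω ∂μ,
      Filter.limsup
        (fun n : ℕ => (V n ω : ℝ) / Real.sqrt (2 * n * Real.log (Real.log n))) atTop = 1)
    (hliminf : ∀ᵐ ω ∂μ,
      Tendsto (fun n : ℕ => (Real.log n) ^ 2 * (V n ω : ℝ) / Real.sqrt (2 * n))
        atTop atTop) :
    (∀ m : ℕ, ∀ᵐ ω ∂μ, hitTimeN V m ω ≠ ⊤) ∧
      ∀ᵐ ω ∂μ, ∀ ε > (0 : ℝ), ∀ᶠ N : ℕ in atTop,
        ∀ k n : ℕ, 1 ≤ k → k ≤ N →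
          hitTimeN V k ω ≤ (n : ℕ∞) → (n : ℕ∞) < hitTimeN V (k + 1) ω →
            (Real.log k - Real.log (V n ω)) / Real.log N < ε := by
  have hstep : ∀ᵐ ω ∂μ, ∀ n, V (n + 1) ω ≤ V n ω + 1 :=
    ae_all_iff.2 (aux_step Ω μ V hmeas hupstep hdownstep)
  have h0 : ∀ᵐ ω ∂μ, V 0 ω = 0 := by
    have mS : MeasurableSet {ω | V 0 ω = 0} := hmeas 0 (measurableSet_singleton 0)
    exact (prob_compl_eq_zero_iff mS).2 hstart
  refine ⟨fun m => ?_, ?_⟩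
  · filter_upwards [hstep, h0, hlimsup, hliminf] with ω hs h00 hls hli htop
    have hne : ∀ n, V n ω ≠ m := by
      intro n hn
      have : hitTimeN V m ω ≤ (n : ℕ∞) := iInf₂_le n hn
      rw [htop] at this
      exact absurd this (by simp)
    have hlt : ∀ n, V n ω < m := by
      intro n
      induction n with
      | zero => have := hne 0; omega
      | succ n ih => have := hs n; have := hne (n + 1); omega
    obtain ⟨n1, hn1⟩ := aux_det (fun n => V n ω) hls hli (1/4) (by norm_num)
    have hlog : Tendsto (fun n : ℕ => Real.log (n : ℝ)) atTop atTop :=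
      Real.tendsto_log_atTop.comp tendsto_natCast_atTop_atTop
    obtain ⟨j, hj, hj1⟩ := ((hlog.eventually_gt_atTop (4 * (m : ℝ))).and
      (eventually_ge_atTop n1)).exists
    have h1 := (hn1 j hj1).2.1
    have h2 : Real.log (V j ω) ≤ V j ω := Real.log_le_self (Nat.cast_nonneg _)
    have h3 : (V j ω : ℝ) < m := by exact_mod_cast hlt j
    linarith
  · filter_upwards [hlimsup, hliminf] with ω hls hli ε hε
    set δ := min (1/4) (ε / 16) with hδ
    have hδ0 : 0 < δ := by positivity
    have hδ1 : δ ≤ 1/4 := min_le_left _ _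
    have hδ2 : δ ≤ ε / 16 := min_le_right _ _
    obtain ⟨n1, hn1⟩ := aux_det (fun n => V n ω) hls hli δ hδ0
    have hlog : Tendsto (fun n : ℕ => Real.log (n : ℝ)) atTop atTop :=
      Real.tendsto_log_atTop.comp tendsto_natCast_atTop_atTop
    set K := ∑ j ∈ Finset.range n1, V j ω with hK
    filter_upwards [hlog.eventually_gt_atTop (max 0 ((K : ℝ) / ε))] with N hN k n hk1 hkN hτ _
    have hN0 : 0 < Real.log (N : ℝ) := lt_of_le_of_lt (le_max_left _ _) hN
    have hNK : (K : ℝ) < Real.log N * ε := by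
      have := lt_of_le_of_lt (le_max_right _ _) hN
      rwa [div_lt_iff₀ hε] at this
    rw [div_lt_iff₀ hN0]
    obtain ⟨j, hjn, hj⟩ := aux_hit V k n ω hτ
    have hk0 : (0 : ℝ) < k := by exact_mod_cast hk1
    by_cases hjn1 : j < n1
    · have h1 : k ≤ K := by
        rw [← hj]
        exact Finset.single_le_sum (f := fun j => V j ω) (fun _ _ => Nat.zero_le _)
          (Finset.mem_range.2 hjn1)
      have h1' : (k : ℝ) ≤ K := by exact_mod_cast h1
      have h2 : Real.log (k : ℝ) ≤ k := Real.log_le_self hk0.le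
      have h3 : 0 ≤ Real.log (V n ω : ℝ) := Real.log_natCast_nonneg _
      linarith
    · push Not at hjn1
      obtain ⟨a1, a2, a3⟩ := hn1 j hjn1
      obtain ⟨b1, b2, b3⟩ := hn1 n (hjn1.trans hjn)
      rw [hj] at a1 a2
      have hkl : Real.log (k : ℝ) ≤ Real.log N :=
        Real.log_le_log hk0 (by exact_mod_cast hkN)
      have hjl : Real.log (j : ℝ) ≤ Real.log n := by
        rcases Nat.eq_zero_or_pos j with h | h
        · rw [h]; simpa using b3
        · exact Real.log_le_log (by exact_mod_cast h) (by exact_mod_cast hjn)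
      have c1 : (1/2 - δ) * Real.log j ≤ (1/2 - δ) * Real.log n :=
        mul_le_mul_of_nonneg_left hjl (by linarith)
      have c2 : Real.log (j : ℝ) ≤ 4 * Real.log N := by nlinarith
      have c3 : δ * Real.log j ≤ (ε / 16) * (4 * Real.log N) :=
        mul_le_mul hδ2 c2 a3 (by positivity)
      nlinarith [mul_pos hε hN0]
end

section
/- Let p ∈ (1/2, 1), r := (1−p)/p, and N ≥ 2. Let W_p* be the Markov chain on ℕ started at 0 which moves from 0 to 1 with probability 1 and from k ≥ 1 up to k+1 with probability (1 − r^{k+1})/((1+r)(1 − r^k)) (down to k−1 with the complementary probability), and let W*_{1/2} be the chain with up-probability (k+1)/(2k) from k ≥ 1. Define the functional M_N(w) := max_{1 ≤ k ≤ N} max_{τ_k(w) ≤ n < τ_{k+1}(w)} ( log_N k − log_N w(n) ), where τ_m(w) is the first visit time of m (both chains visit every level almost surely). Then M_N(W_p*) is stochastically dominated by M_N(W*_{1/2}): for every x ∈ ℝ, ℙ( M_N(W_p*) > x ) ≤ ℙ( M_N(W*_{1/2}) > x ). -/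
open MeasureTheory ProbabilityTheory Filter Set

/-- Upward transition probability of the chain `W*_p`, `r = (1-p)/p`. -/
noncomputable def besselUpP (r : ℝ) (k : ℕ) : ℝ :=
  if k = 0 then 1 else (1 - r ^ (k + 1)) / ((1 + r) * (1 - r ^ k))

/-- The functional `M_N(w) = max_{1 ≤ k ≤ N} max_{τ_k ≤ n < τ_{k+1}} (log_N k - log_N w(n))`. -/
noncomputable def MN {Ω : Type} (N : ℕ) (V : ℕ → Ω → ℕ) (ω : Ω) : ℝ :=
  ⨆ k ∈ Finset.Icc 1 N, ⨆ n : ℕ,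
    ⨆ _ : hitTimeN V k ω ≤ (n : ℕ∞) ∧ (n : ℕ∞) < hitTimeN V (k + 1) ω,
      (Real.log k - Real.log (V n ω)) / Real.log N


namespace Aux15

def rmax (v : ℕ → ℕ) : ℕ → ℕ
  | 0 => v 0
  | n + 1 => max (rmax v n) (v (n + 1))

open Classical in
noncomputable def uu (B : ℕ → ℕ → Prop) (q : ℕ → ℝ) : ℕ → ℕ → ℕ → ℝ
  | 0, m, v => if B m v then 1 else 0
  | j + 1, m, v => if B m v then 1 else
      q v * uu B q j (max m (v + 1)) (v + 1) + (1 - q v) * uu B q j (max m (v - 1)) (v - 1)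

lemma uu_nonneg (B : ℕ → ℕ → Prop) (q : ℕ → ℝ) (h0 : ∀ k, 0 ≤ q k) (h1 : ∀ k, q k ≤ 1)
    (j m v : ℕ) : 0 ≤ uu B q j m v := by
  induction j generalizing m v with
  | zero => simp only [uu]; split_ifs <;> norm_num
  | succ j ih =>
    simp only [uu]; split_ifs
    · norm_num
    · have := h0 v
      have := sub_nonneg.2 (h1 v)
      have := ih (max m (v + 1)) (v + 1)
      have := ih (max m (v - 1)) (v - 1)
      positivity

lemma rmax_congr {v w : ℕ → ℕ} {n : ℕ} (h : ∀ j ≤ n, v j = w j) : rmax v n = rmax w n := by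
  induction n with
  | zero => exact h 0 le_rfl
  | succ n ih =>
    simp only [rmax]
    rw [ih (fun j hj => h j (by omega)), h (n + 1) le_rfl]

lemma le_rmax (v : ℕ → ℕ) {i n : ℕ} (h : i ≤ n) : v i ≤ rmax v n := by
  induction n with
  | zero => obtain rfl : i = 0 := by omega
            exact le_rfl
  | succ n ih =>
    rcases Nat.lt_or_ge n i with h' | h'
    · obtain rfl : i = n + 1 := by omega
      exact le_max_right _ _
    · exact (ih h').trans (le_max_left _ _)

lemma exists_of_le_rmax {v : ℕ → ℕ} (h0 : v 0 = 0) (hs : ∀ n, v (n + 1) ≤ v n + 1) {n k : ℕ}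
    (hk : k ≤ rmax v n) : ∃ i ≤ n, v i = k := by
  induction n with
  | zero => simp only [rmax] at hk; exact ⟨0, le_rfl, by omega⟩
  | succ n ih =>
    by_cases h : k ≤ rmax v n
    · obtain ⟨i, hi, h⟩ := ih h
      exact ⟨i, by omega, h⟩
    · have h1 : k ≤ v (n + 1) := by simp only [rmax] at hk; omega
      have h2 := le_rmax v (le_refl n)
      have := hs n
      exact ⟨n + 1, le_rfl, by omega⟩

section meas
variable {Ω : Type} [MeasurableSpace Ω] (μ : Measure Ω) [IsProbabilityMeasure μ]
    (V : ℕ → Ω → ℕ) (q : ℕ → ℝ)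

def cyl (V : ℕ → Ω → ℕ) (n : ℕ) (v : ℕ → ℕ) : Set Ω := {ω | ∀ j ≤ n, V j ω = v j}

def FF (V : ℕ → Ω → ℕ) (B : ℕ → ℕ → Prop) (n j : ℕ) : Set Ω :=
  {ω | ∃ i ≤ j, B (rmax (fun t => V t ω) (n + i)) (V (n + i) ω)}

lemma null_cyl (hmeas : ∀ n, Measurable (V n)) (h0 : ∀ k, 0 ≤ q k) (h1 : ∀ k, q k ≤ 1)
    (hup : ∀ (n : ℕ) (v : ℕ → ℕ), μ (cyl V n v ∩ {ω | V (n + 1) ω = v n + 1}) =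
        ENNReal.ofReal (q (v n)) * μ (cyl V n v))
    (hdown : ∀ (n : ℕ) (v : ℕ → ℕ), μ (cyl V n v ∩ {ω | V (n + 1) ω = v n - 1}) =
        ENNReal.ofReal (1 - q (v n)) * μ (cyl V n v)) (n : ℕ) (v : ℕ → ℕ) :
    μ (cyl V n v ∩ {ω | V (n + 1) ω ≠ v n + 1 ∧ V (n + 1) ω ≠ v n - 1}) = 0 := by
  have mU : MeasurableSet {ω | V (n + 1) ω = v n + 1} := hmeas (n + 1) (measurableSet_singleton _)
  have mD : MeasurableSet {ω | V (n + 1) ω = v n - 1} := hmeas (n + 1) (measurableSet_singleton _)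
  have e1 := measure_inter_add_diff (μ := μ) (cyl V n v) mU
  have e2 := measure_inter_add_diff (μ := μ) (cyl V n v \ {ω | V (n + 1) ω = v n + 1}) mD
  have e3 : (cyl V n v \ {ω | V (n + 1) ω = v n + 1}) ∩ {ω | V (n + 1) ω = v n - 1}
      = cyl V n v ∩ {ω | V (n + 1) ω = v n - 1} := by
    ext ω; simp only [mem_inter_iff, mem_diff, mem_setOf_eq]
    constructor
    · rintro ⟨⟨a, b⟩, c⟩; exact ⟨a, c⟩
    · rintro ⟨a, c⟩; exact ⟨⟨a, by omega⟩, c⟩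
  have e4 : (cyl V n v \ {ω | V (n + 1) ω = v n + 1}) \ {ω | V (n + 1) ω = v n - 1}
      = cyl V n v ∩ {ω | V (n + 1) ω ≠ v n + 1 ∧ V (n + 1) ω ≠ v n - 1} := by
    ext ω; simp only [mem_inter_iff, mem_diff, mem_setOf_eq]; tauto
  rw [e3, e4, hdown] at e2
  rw [← e2, hup, ← add_assoc, ← add_mul, ← ENNReal.ofReal_add (h0 _) (sub_nonneg.2 (h1 _))] at e1
  simp only [add_sub_cancel, ENNReal.ofReal_one, one_mul] at e1
  have hfin : μ (cyl V n v) ≠ ⊤ := measure_ne_top _ _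
  refine (ENNReal.add_right_inj hfin).1 ?_
  rw [e1, add_zero]

lemma key (hmeas : ∀ n, Measurable (V n)) (h0 : ∀ k, 0 ≤ q k) (h1 : ∀ k, q k ≤ 1)
    (hup : ∀ (n : ℕ) (v : ℕ → ℕ), μ (cyl V n v ∩ {ω | V (n + 1) ω = v n + 1}) =
        ENNReal.ofReal (q (v n)) * μ (cyl V n v))
    (hdown : ∀ (n : ℕ) (v : ℕ → ℕ), μ (cyl V n v ∩ {ω | V (n + 1) ω = v n - 1}) =
        ENNReal.ofReal (1 - q (v n)) * μ (cyl V n v)) (B : ℕ → ℕ → Prop)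
    (j n : ℕ) (v : ℕ → ℕ) :
    μ (cyl V n v ∩ FF V B n j) = ENNReal.ofReal (uu B q j (rmax v n) (v n)) * μ (cyl V n v) := by
  have hcyl : ∀ (n : ℕ) (v : ℕ → ℕ) ω, ω ∈ cyl V n v →
      (rmax (fun t => V t ω) n = rmax v n ∧ V n ω = v n) := by
    intro n v ω h
    exact ⟨rmax_congr h, h n le_rfl⟩
  have hB : ∀ (j n : ℕ) (v : ℕ → ℕ), B (rmax v n) (v n) → cyl V n v ∩ FF V B n j = cyl V n v := by
    intro j n v hb
    refine inter_eq_left.2 fun ω hω => ⟨0, Nat.zero_le _, ?_⟩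
    obtain ⟨e1, e2⟩ := hcyl n v ω hω
    simp only [add_zero]
    rw [e1, e2]; exact hb
  induction j generalizing n v with
  | zero =>
    by_cases hb : B (rmax v n) (v n)
    · rw [hB _ _ _ hb]; simp [uu, hb]
    · have : cyl V n v ∩ FF V B n 0 = ∅ := by
        ext ω
        simp only [mem_inter_iff, mem_empty_iff_false, iff_false, not_and]
        rintro hω ⟨i, hi, h⟩
        obtain rfl : i = 0 := by omega
        obtain ⟨e1, e2⟩ := hcyl n v ω hω
        simp only [add_zero] at h
        rw [e1, e2] at h; exact hb h
      rw [this]; simp [uu, hb]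
  | succ j ih =>
    by_cases hb : B (rmax v n) (v n)
    · rw [hB _ _ _ hb]; simp [uu, hb]
    have hE : cyl V n v ∩ FF V B n (j + 1) = cyl V n v ∩ FF V B (n + 1) j := by
      ext ω
      simp only [mem_inter_iff, and_congr_right_iff]
      intro hω
      obtain ⟨e1, e2⟩ := hcyl n v ω hω
      constructor
      · rintro ⟨i, hi, h⟩
        rcases i with _ | i
        · simp only [add_zero] at h
          rw [e1, e2] at h; exact absurd h hb
        · refine ⟨i, by omega, ?_⟩
          rw [show n + 1 + i = n + (i + 1) by ring]; exact h
      · rintro ⟨i, hi, h⟩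
        refine ⟨i + 1, by omega, ?_⟩
        rw [show n + (i + 1) = n + 1 + i by ring]; exact h
    have hstep : ∀ a : ℕ, cyl V (n + 1) (Function.update v (n + 1) a)
        = cyl V n v ∩ {ω | V (n + 1) ω = a} := by
      intro a; ext ω
      simp only [cyl, mem_setOf_eq, mem_inter_iff]
      constructor
      · intro h
        refine ⟨fun i hi => ?_, ?_⟩
        · have := h i (by omega)
          rwa [Function.update_of_ne (by omega)] at this
        · have := h (n + 1) le_rfl
          rwa [Function.update_self] at this
      · rintro ⟨h, h'⟩ i hi
        rcases Nat.lt_or_ge n i with h2 | h2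
        · obtain rfl : i = n + 1 := by omega
          rw [Function.update_self]; exact h'
        · rw [Function.update_of_ne (by omega)]; exact h i h2
    have hr : ∀ a : ℕ, rmax (Function.update v (n + 1) a) (n + 1) = max (rmax v n) a := by
      intro a
      simp only [rmax, Function.update_self]
      rw [rmax_congr (w := v) (fun i hi => Function.update_of_ne (by omega) _ _)]
    have hpiece : ∀ a : ℕ, μ (cyl V n v ∩ FF V B (n + 1) j ∩ {ω | V (n + 1) ω = a})
        = ENNReal.ofReal (uu B q j (max (rmax v n) a) a) * μ (cyl V n v ∩ {ω | V (n + 1) ω = a}) := by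
      intro a
      have := ih (n + 1) (Function.update v (n + 1) a)
      rw [hstep, hr, Function.update_self] at this
      rw [← this, inter_right_comm]
    have mU : MeasurableSet {ω | V (n + 1) ω = v n + 1} := hmeas (n + 1) (measurableSet_singleton _)
    have hD : μ ((cyl V n v ∩ FF V B (n + 1) j) \ {ω | V (n + 1) ω = v n + 1})
        = μ (cyl V n v ∩ FF V B (n + 1) j ∩ {ω | V (n + 1) ω = v n - 1}) := by
      apply le_antisymm
      · have hsub : (cyl V n v ∩ FF V B (n + 1) j) \ {ω | V (n + 1) ω = v n + 1} ⊆
            (cyl V n v ∩ FF V B (n + 1) j ∩ {ω | V (n + 1) ω = v n - 1}) ∪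
            (cyl V n v ∩ {ω | V (n + 1) ω ≠ v n + 1 ∧ V (n + 1) ω ≠ v n - 1}) := by
          intro ω
          simp only [mem_inter_iff, mem_diff, mem_setOf_eq, mem_union]; tauto
        refine (measure_mono hsub).trans ((measure_union_le _ _).trans ?_)
        rw [null_cyl μ V q hmeas h0 h1 hup hdown, add_zero]
      · apply measure_mono
        intro ω
        simp only [mem_inter_iff, mem_diff, mem_setOf_eq]
        rintro ⟨a, c⟩; exact ⟨a, by omega⟩
    rw [hE, ← measure_inter_add_diff _ mU, hD, hpiece, hpiece, hup, hdown, uu, if_neg hb,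
      ENNReal.ofReal_add, ENNReal.ofReal_mul (h0 _), ENNReal.ofReal_mul (sub_nonneg.2 (h1 _))]
    · ring
    · exact mul_nonneg (h0 _) (uu_nonneg B q h0 h1 _ _ _)
    · exact mul_nonneg (sub_nonneg.2 (h1 _)) (uu_nonneg B q h0 h1 _ _ _)

lemma measFF (hmeas : ∀ n, Measurable (V n)) (h0 : ∀ k, 0 ≤ q k) (h1 : ∀ k, q k ≤ 1)
    (hs : μ {ω | V 0 ω = 0} = 1)
    (hup : ∀ (n : ℕ) (v : ℕ → ℕ), μ (cyl V n v ∩ {ω | V (n + 1) ω = v n + 1}) =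
        ENNReal.ofReal (q (v n)) * μ (cyl V n v))
    (hdown : ∀ (n : ℕ) (v : ℕ → ℕ), μ (cyl V n v ∩ {ω | V (n + 1) ω = v n - 1}) =
        ENNReal.ofReal (1 - q (v n)) * μ (cyl V n v)) (B : ℕ → ℕ → Prop) (j : ℕ) :
    μ (FF V B 0 j) = ENNReal.ofReal (uu B q j 0 0) := by
  have h := key μ V q hmeas h0 h1 hup hdown B j 0 (fun _ => 0)
  have hc : cyl V 0 (fun _ => 0) = {ω | V 0 ω = 0} := by
    ext ω; simp [cyl]
  have hae : ∀ᵐ ω ∂μ, V 0 ω = 0 := by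
    have : MeasurableSet {ω | V 0 ω = 0} := hmeas 0 (measurableSet_singleton _)
    exact (prob_compl_eq_zero_iff this).2 hs
  rw [hc, hs, mul_one] at h
  simp only [rmax] at h
  rw [← h]
  apply measure_congr
  filter_upwards [hae] with ω hω
  apply propext
  exact ⟨fun h => ⟨hω, h⟩, fun h => h.2⟩

lemma ae_good (hmeas : ∀ n, Measurable (V n)) (h0 : ∀ k, 0 ≤ q k) (h1 : ∀ k, q k ≤ 1)
    (hs : μ {ω | V 0 ω = 0} = 1)
    (hup : ∀ (n : ℕ) (v : ℕ → ℕ), μ (cyl V n v ∩ {ω | V (n + 1) ω = v n + 1}) =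
        ENNReal.ofReal (q (v n)) * μ (cyl V n v))
    (hdown : ∀ (n : ℕ) (v : ℕ → ℕ), μ (cyl V n v ∩ {ω | V (n + 1) ω = v n - 1}) =
        ENNReal.ofReal (1 - q (v n)) * μ (cyl V n v)) :
    ∀ᵐ ω ∂μ, V 0 ω = 0 ∧ ∀ n, V (n + 1) ω ≤ V n ω + 1 := by
  have hae : ∀ᵐ ω ∂μ, V 0 ω = 0 := by
    have : MeasurableSet {ω | V 0 ω = 0} := hmeas 0 (measurableSet_singleton _)
    exact (prob_compl_eq_zero_iff this).2 hs
  have hst : ∀ᵐ ω ∂μ, ∀ n, V (n + 1) ω ≤ V n ω + 1 := by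
    rw [ae_all_iff]
    intro n
    let ext : (Fin (n + 1) → ℕ) → ℕ → ℕ := fun w i => if h : i < n + 1 then w ⟨i, h⟩ else 0
    have hall : ∀ᵐ ω ∂μ, ∀ w : Fin (n + 1) → ℕ, ¬ (ω ∈ cyl V n (ext w) ∩
        {ω | V (n + 1) ω ≠ ext w n + 1 ∧ V (n + 1) ω ≠ ext w n - 1}) := by
      rw [ae_all_iff]
      intro w
      have := null_cyl μ V q hmeas h0 h1 hup hdown n (ext w)
      exact measure_eq_zero_iff_ae_notMem.1 this
    filter_upwards [hall] with ω hω
    by_contra hcon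
    apply hω (fun i => V i ω)
    refine ⟨fun i hi => ?_, ?_⟩
    · simp only [ext]; rw [dif_pos (by omega)]
    · have : ext (fun i => V i ω) n = V n ω := by simp only [ext]; rw [dif_pos (by omega)]
      simp only [mem_setOf_eq, this]
      omega
  filter_upwards [hae, hst] with ω a b using ⟨a, b⟩

end meas

/-- bad states -/
def BB (N : ℕ) (x : ℝ) (m v : ℕ) : Prop :=
  1 ≤ m ∧ m ≤ N ∧ x < (Real.log m - Real.log v) / Real.log N

lemma MN_nonneg {Ω : Type} (N : ℕ) (hN : 2 ≤ N) (V : ℕ → Ω → ℕ) (ω : Ω) : 0 ≤ MN N V ω := by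
  have hlogN : 0 < Real.log N := Real.log_pos (by exact_mod_cast hN)
  have hb3 : ∀ k : ℕ, (⨆ _ : k ∈ Finset.Icc 1 N, ⨆ n : ℕ,
      ⨆ _ : hitTimeN V k ω ≤ (n : ℕ∞) ∧ (n : ℕ∞) < hitTimeN V (k + 1) ω,
      (Real.log k - Real.log (V n ω)) / Real.log N) ≤ 1 := by
    intro k
    refine Real.iSup_le (fun h => Real.iSup_le (fun n => Real.iSup_le (fun _ => ?_)
      zero_le_one) zero_le_one) zero_le_one
    rw [Finset.mem_Icc] at h
    rw [div_le_one hlogN]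
    have h1 := Real.log_natCast_nonneg (V n ω)
    have h2 : Real.log k ≤ Real.log N :=
      Real.log_le_log (by exact_mod_cast h.1) (by exact_mod_cast h.2)
    linarith
  unfold MN
  refine le_trans ?_ (le_ciSup (f := fun k : ℕ => ⨆ _ : k ∈ Finset.Icc 1 N, ⨆ n : ℕ,
      ⨆ _ : hitTimeN V k ω ≤ (n : ℕ∞) ∧ (n : ℕ∞) < hitTimeN V (k + 1) ω,
      (Real.log k - Real.log (V n ω)) / Real.log N)
      ⟨1, by rintro _ ⟨k, rfl⟩; exact hb3 k⟩ 0)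
  simp

lemma MN_iff {Ω : Type} (N : ℕ) (hN : 2 ≤ N) (V : ℕ → Ω → ℕ) (ω : Ω) (h0 : V 0 ω = 0)
    (hs : ∀ n, V (n + 1) ω ≤ V n ω + 1) (x : ℝ) (hx : 0 ≤ x) :
    x < MN N V ω ↔ ∃ n, BB N x (rmax (fun t => V t ω) n) (V n ω) := by
  have hlogN : 0 < Real.log N := Real.log_pos (by exact_mod_cast hN)
  have hhit : ∀ k n : ℕ, hitTimeN V k ω ≤ (n : ℕ∞) ↔ k ≤ rmax (fun t => V t ω) n := by
    intro k n
    constructor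
    · intro h
      have h' : hitTimeN V k ω < ((n + 1 : ℕ) : ℕ∞) :=
        lt_of_le_of_lt h (by exact_mod_cast Nat.lt_succ_self n)
      simp only [hitTimeN, iInf_lt_iff] at h'
      obtain ⟨i, hi, hlt⟩ := h'
      have : i < n + 1 := by exact_mod_cast hlt
      rw [← hi]
      exact le_rmax (fun t => V t ω) (by omega)
    · intro h
      obtain ⟨i, hi, e⟩ := exists_of_le_rmax (v := fun t => V t ω) h0 hs h
      exact (iInf₂_le i e).trans (by exact_mod_cast hi)
  have hwin : ∀ k n : ℕ, (hitTimeN V k ω ≤ (n : ℕ∞) ∧ (n : ℕ∞) < hitTimeN V (k + 1) ω) ↔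
      rmax (fun t => V t ω) n = k := by
    intro k n
    rw [← not_le, hhit, hhit]; omega
  have hMN : MN N V ω = ⨆ k : ℕ, ⨆ _ : k ∈ Finset.Icc 1 N, ⨆ n : ℕ,
      ⨆ _ : rmax (fun t => V t ω) n = k, (Real.log k - Real.log (V n ω)) / Real.log N := by
    unfold MN
    simp only [hwin]
  have hle : ∀ k n : ℕ, (Real.log k - Real.log (V n ω)) / Real.log N ≤ Real.log k / Real.log N := by
    intro k n
    have := Real.log_natCast_nonneg (V n ω)
    gcongr; linarith
  have hk0 : ∀ k : ℕ, 0 ≤ Real.log k / Real.log N := fun k =>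
    div_nonneg (Real.log_natCast_nonneg k) hlogN.le
  have hb1 : ∀ k n : ℕ, (⨆ _ : rmax (fun t => V t ω) n = k,
      (Real.log k - Real.log (V n ω)) / Real.log N) ≤ Real.log k / Real.log N := by
    intro k n
    exact Real.iSup_le (fun _ => hle k n) (hk0 k)
  have hb2 : ∀ k : ℕ, (⨆ n : ℕ, ⨆ _ : rmax (fun t => V t ω) n = k,
      (Real.log k - Real.log (V n ω)) / Real.log N) ≤ Real.log k / Real.log N := by
    intro k
    exact Real.iSup_le (fun n => hb1 k n) (hk0 k)
  have hb3 : ∀ k : ℕ, (⨆ _ : k ∈ Finset.Icc 1 N, ⨆ n : ℕ, ⨆ _ : rmax (fun t => V t ω) n = k,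
      (Real.log k - Real.log (V n ω)) / Real.log N) ≤ 1 := by
    intro k
    refine Real.iSup_le (fun h => (hb2 k).trans ?_) zero_le_one
    rw [Finset.mem_Icc] at h
    rw [div_le_one hlogN]
    exact Real.log_le_log (by exact_mod_cast h.1) (by exact_mod_cast h.2)
  rw [hMN]
  constructor
  · intro h
    by_contra hcon
    push Not at hcon
    apply absurd h
    rw [not_lt]
    refine Real.iSup_le (fun k => Real.iSup_le (fun hk => Real.iSup_le (fun n =>
      Real.iSup_le (fun e => ?_) hx) hx) hx) hx
    have := hcon n
    rw [Finset.mem_Icc] at hk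
    by_contra hlt
    rw [not_le] at hlt
    apply this
    unfold BB
    rw [e]
    exact ⟨hk.1, hk.2, hlt⟩
  · rintro ⟨n, hm, hmN, hlt⟩
    refine lt_of_lt_of_le hlt ?_
    set k := rmax (fun t => V t ω) n with hk
    refine le_trans ?_ (le_ciSup (f := fun k : ℕ => ⨆ _ : k ∈ Finset.Icc 1 N, ⨆ n : ℕ,
      ⨆ _ : rmax (fun t => V t ω) n = k, (Real.log k - Real.log (V n ω)) / Real.log N)
      ⟨1, by rintro _ ⟨k, rfl⟩; exact hb3 k⟩ k)
    have hmem : k ∈ Finset.Icc 1 N := Finset.mem_Icc.2 ⟨hm, hmN⟩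
    simp only [ciSup_pos hmem]
    refine le_trans ?_ (le_ciSup (f := fun n : ℕ =>
      ⨆ _ : rmax (fun t => V t ω) n = k, (Real.log k - Real.log (V n ω)) / Real.log N)
      ⟨_, by rintro _ ⟨n, rfl⟩; exact hb1 k n⟩ n)
    simp only [ciSup_pos hk.symm]
    exact le_rfl

section pot
open Classical in
noncomputable def ll (N : ℕ) (x : ℝ) (m : ℕ) : ℕ := Nat.findGreatest (fun v => BB N x m v) m

noncomputable def ss (N : ℕ) (x : ℝ) (m v : ℕ) : ℝ :=
  ((v - ll N x m : ℕ) : ℝ) * ((m : ℝ) + 1) / ((v : ℝ) * ((m + 1 - ll N x m : ℕ) : ℝ))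

noncomputable def GG (N : ℕ) (x : ℝ) (m : ℕ) : ℝ := ∏ k ∈ Finset.Ico m (N + 1), ss N x k k

noncomputable def UU (N : ℕ) (x : ℝ) (m v : ℕ) : ℝ :=
  if m ≤ N then 1 - ss N x m v * GG N x (m + 1) else 0

variable (N : ℕ) (x : ℝ)

lemma ll_le (m : ℕ) : ll N x m ≤ m := by
  classical
  exact Nat.findGreatest_le m

lemma bad_iff (hN : 2 ≤ N) {m v : ℕ} (hv : 1 ≤ v) (hvm : v ≤ m) : BB N x m v ↔ v ≤ ll N x m := by
  classical
  have hlogN : 0 < Real.log N := Real.log_pos (by exact_mod_cast hN)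
  constructor
  · intro h
    exact Nat.le_findGreatest hvm h
  · intro h
    have h2 : BB N x m (ll N x m) :=
      Nat.findGreatest_of_ne_zero (P := fun v => BB N x m v) (n := m) rfl (by
        change ll N x m ≠ 0
        omega)
    refine ⟨h2.1, h2.2.1, h2.2.2.trans_le ?_⟩
    have : Real.log v ≤ Real.log (ll N x m) :=
      Real.log_le_log (by exact_mod_cast hv) (by exact_mod_cast h)
    gcongr

lemma ss_nonneg (m v : ℕ) : 0 ≤ ss N x m v := by unfold ss; positivity

lemma den_pos (m : ℕ) : (0 : ℝ) < ((m + 1 - ll N x m : ℕ) : ℝ) := by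
  have := ll_le N x m
  exact_mod_cast (by omega : 0 < m + 1 - ll N x m)

lemma ss_le_one {m v : ℕ} (hv : 1 ≤ v) (h : v ≤ m + 1) : ss N x m v ≤ 1 := by
  have hd := den_pos N x m
  have hl := ll_le N x m
  have hv' : (0 : ℝ) < v := by exact_mod_cast hv
  unfold ss
  rw [div_le_one (by positivity)]
  rcases le_total v (ll N x m) with h' | h'
  · rw [Nat.sub_eq_zero_of_le h']; simp; positivity
  · rw [Nat.cast_sub h', Nat.cast_sub (by omega)]
    have : (v : ℝ) ≤ m + 1 := by exact_mod_cast h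
    push_cast
    nlinarith [(Nat.cast_nonneg (ll N x m) : (0 : ℝ) ≤ _)]

lemma ss_top (m : ℕ) : ss N x m (m + 1) = 1 := by
  have hd := den_pos N x m
  unfold ss
  push_cast
  have : (0 : ℝ) < (m : ℝ) + 1 := by positivity
  field_simp

lemma ss_mono {m v w : ℕ} (hv : 1 ≤ v) (h : v ≤ w) : ss N x m v ≤ ss N x m w := by
  have hd := den_pos N x m
  have hv' : (0 : ℝ) < v := by exact_mod_cast hv
  have hw' : (0 : ℝ) < w := by exact_mod_cast (by omega : 0 < w)
  rcases le_total v (ll N x m) with h' | h'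
  · have : ss N x m v = 0 := by unfold ss; rw [Nat.sub_eq_zero_of_le h']; simp
    rw [this]; exact ss_nonneg N x m w
  · have key : ((v - ll N x m : ℕ) : ℝ) * w ≤ ((w - ll N x m : ℕ) : ℝ) * v := by
      rw [Nat.cast_sub h', Nat.cast_sub (by omega)]
      have : (v : ℝ) ≤ w := by exact_mod_cast h
      nlinarith [(Nat.cast_nonneg (ll N x m) : (0 : ℝ) ≤ _)]
    unfold ss
    rw [div_le_div_iff₀ (by positivity) (by positivity)]
    have hm : (0 : ℝ) ≤ ((m : ℝ) + 1) * ((m + 1 - ll N x m : ℕ) : ℝ) := by positivity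
    nlinarith [mul_le_mul_of_nonneg_right key hm]

lemma ss_bad {m v : ℕ} (h : v ≤ ll N x m) : ss N x m v = 0 := by
  unfold ss; rw [Nat.sub_eq_zero_of_le h]; simp

lemma ss_harm {m v : ℕ} (hv : 1 ≤ v) (h : ll N x m < v) :
    besselUp v * ss N x m (v + 1) + (1 - besselUp v) * ss N x m (v - 1) = ss N x m v := by
  have hd := den_pos N x m
  have hv' : (0 : ℝ) < v := by exact_mod_cast hv
  by_cases hv1 : v = 1
  · subst hv1
    have hl : ll N x m = 0 := by omega
    have hb : besselUp 1 = 1 := by norm_num [besselUp]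
    have hm : ((m : ℝ) + 1) ≠ 0 := by positivity
    rw [hb]
    simp [ss, hl]
    field_simp
  unfold besselUp
  rw [if_neg (by omega)]
  obtain ⟨w, rfl⟩ : ∃ w, v = w + 1 := ⟨v - 1, by omega⟩
  unfold ss
  have e1 : ((w + 1 + 1 - ll N x m : ℕ) : ℝ) = (w : ℝ) + 2 - ll N x m := by
    rw [Nat.cast_sub (by omega)]; push_cast; ring
  have e2 : ((w + 1 - ll N x m : ℕ) : ℝ) = (w : ℝ) + 1 - ll N x m := by
    rw [Nat.cast_sub (by omega)]; push_cast; ring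
  have e3 : ((w + 1 - 1 - ll N x m : ℕ) : ℝ) = (w : ℝ) - ll N x m := by
    rw [Nat.cast_sub (by omega)]; push_cast; ring
  rw [e1, e2, e3]
  generalize ((m + 1 - ll N x m : ℕ) : ℝ) = d at *
  generalize (ll N x m : ℝ) = l at *
  simp only [add_tsub_cancel_right]
  push_cast
  have hw' : (0 : ℝ) < w := by exact_mod_cast (by omega : 0 < w)
  field_simp
  ring

lemma GG_nonneg (m : ℕ) : 0 ≤ GG N x m := Finset.prod_nonneg fun k _ => ss_nonneg N x k k

lemma GG_le_one {m : ℕ} (hm : 1 ≤ m) : GG N x m ≤ 1 :=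
  Finset.prod_le_one (fun k _ => ss_nonneg N x k k) fun k hk =>
    ss_le_one N x (by rw [Finset.mem_Ico] at hk; omega) (by omega)

lemma UU_up {m v : ℕ} (hv : 1 ≤ v) (hvm : v ≤ m) (hm : m ≤ N) :
    UU N x (max m (v + 1)) (v + 1) = 1 - ss N x m (v + 1) * GG N x (m + 1) := by
  rcases Nat.lt_or_ge v m with h | h
  · rw [max_eq_left (by omega), UU, if_pos hm]
  · obtain rfl : v = m := by omega
    rw [max_eq_right (by omega), ss_top, one_mul, UU]
    split_ifs with h2
    · rw [GG, GG, Finset.prod_eq_prod_Ico_succ_bot (by omega : v + 1 < N + 1)]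
    · rw [GG, Finset.Ico_eq_empty (by omega)]; simp

lemma UU_down {m v : ℕ} (hvm : v ≤ m) (hm : m ≤ N) :
    UU N x (max m (v - 1)) (v - 1) = 1 - ss N x m (v - 1) * GG N x (m + 1) := by
  rw [max_eq_left (by omega), UU, if_pos hm]

lemma UU_nonneg {m v : ℕ} (hv : 1 ≤ v) (hvm : v ≤ m) : 0 ≤ UU N x m v := by
  unfold UU; split_ifs
  · have := mul_le_one₀ (ss_le_one N x hv (by omega : v ≤ m + 1)) (GG_nonneg N x (m + 1))
      (GG_le_one N x (by omega))
    linarith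
  · exact le_rfl

lemma UU_le_one (m v : ℕ) : UU N x m v ≤ 1 := by
  unfold UU; split_ifs
  · have := mul_nonneg (ss_nonneg N x m v) (GG_nonneg N x (m + 1))
    linarith
  · exact zero_le_one

lemma up_le (hN : 2 ≤ N) (q : ℕ → ℝ) (hq0 : ∀ k, 0 ≤ q k) (hq1 : ∀ k, q k ≤ 1) (hone : q 1 = 1)
    (hq : ∀ k, besselUp k ≤ q k) (j m v : ℕ) (hv : 1 ≤ v) (hvm : v ≤ m) :
    uu (BB N x) q j m v ≤ UU N x m v := by
  induction j generalizing m v with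
  | zero =>
    rw [uu]; split_ifs with hb
    · rw [UU, if_pos hb.2.1, ss_bad N x ((bad_iff N x hN hv hvm).1 hb)]; simp
    · exact UU_nonneg N x hv hvm
  | succ j ih =>
    rw [uu]; split_ifs with hb
    · rw [UU, if_pos hb.2.1, ss_bad N x ((bad_iff N x hN hv hvm).1 hb)]; simp
    have i1 := ih (max m (v + 1)) (v + 1) (by omega) (le_max_right _ _)
    have hd : (1 - q v) * uu (BB N x) q j (max m (v - 1)) (v - 1) ≤
        (1 - q v) * UU N x (max m (v - 1)) (v - 1) := by
      rcases Nat.lt_or_ge 1 v with h | h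
      · exact mul_le_mul_of_nonneg_left (ih _ _ (by omega) (le_max_right _ _))
          (sub_nonneg.2 (hq1 v))
      · obtain rfl : v = 1 := by omega
        simp [hone]
    have hu := mul_le_mul_of_nonneg_left i1 (hq0 v)
    refine (add_le_add hu hd).trans ?_
    by_cases hm : m ≤ N
    · rw [UU_up N x hv hvm hm, UU_down N x hvm hm, UU, if_pos hm]
      have hl : ll N x m < v := by
        by_contra h; exact hb ((bad_iff N x hN hv hvm).2 (by omega))
      rw [← ss_harm N x hv hl]
      have hG := GG_nonneg N x (m + 1)
      rcases Nat.lt_or_ge 1 v with h | h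
      · have hmono := ss_mono N x (m := m) (v := v - 1) (w := v + 1) (by omega) (by omega)
        have := mul_nonneg (mul_nonneg (sub_nonneg.2 (hq v)) (sub_nonneg.2 hmono)) hG
        nlinarith
      · obtain rfl : v = 1 := by omega
        have : besselUp 1 = 1 := by norm_num [besselUp]
        rw [hone, this]; simp
    · have a1 : UU N x (max m (v + 1)) (v + 1) = 0 := by
        rw [UU, if_neg (by have := le_max_left m (v + 1); omega)]
      have a2 : UU N x (max m (v - 1)) (v - 1) = 0 := by
        rw [UU, if_neg (by have := le_max_left m (v - 1); omega)]
      rw [a1, a2, UU, if_neg hm]; simp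

lemma bu0 (k : ℕ) : 0 ≤ besselUp k := by
  unfold besselUp; split_ifs
  · norm_num
  · positivity

lemma bu1 (k : ℕ) : besselUp k ≤ 1 := by
  unfold besselUp; split_ifs with h
  · norm_num
  · have : (1 : ℝ) ≤ k := by exact_mod_cast Nat.one_le_iff_ne_zero.2 h
    rw [div_le_one (by positivity)]; linarith

lemma low_le (hN : 2 ≤ N) (H : ℕ) (hH : 1 ≤ H) (j : ℕ) (hj : j ≤ H) (m v : ℕ) (hv : 1 ≤ v)
    (hvm : v ≤ m) (hm : m ≤ N + 1) :
    UU N x m v ≤ uu (BB N x) besselUp j m v +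
      (((N : ℝ) + 1) ^ 2 - (v : ℝ) ^ 2 + ((H : ℝ) - j)) / H := by
  have hH' : (0 : ℝ) < H := by exact_mod_cast hH
  induction j generalizing m v with
  | zero =>
    have h1 := UU_le_one N x m v
    have h2 := uu_nonneg (BB N x) besselUp bu0 bu1 0 m v
    have hvN : (v : ℝ) ≤ N + 1 := by exact_mod_cast hvm.trans hm
    have h3 : 1 ≤ (((N : ℝ) + 1) ^ 2 - (v : ℝ) ^ 2 + ((H : ℝ) - (0 : ℕ))) / H := by
      rw [le_div_iff₀ hH']; push_cast
      nlinarith [(Nat.cast_nonneg v : (0 : ℝ) ≤ v)]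
    linarith
  | succ j ih =>
    have hvN : (v : ℝ) ≤ N + 1 := by exact_mod_cast hvm.trans hm
    have hjH : (((j + 1 : ℕ)) : ℝ) ≤ H := by exact_mod_cast hj
    have hD : 0 ≤ (((N : ℝ) + 1) ^ 2 - (v : ℝ) ^ 2 + ((H : ℝ) - (j + 1 : ℕ))) / H := by
      apply div_nonneg _ hH'.le
      nlinarith [(Nat.cast_nonneg v : (0 : ℝ) ≤ v)]
    by_cases hmN : m ≤ N
    swap
    · have h2 := uu_nonneg (BB N x) besselUp bu0 bu1 (j + 1) m v
      rw [UU, if_neg hmN]; linarith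
    rw [uu]; split_ifs with hb
    · have h1 := UU_le_one N x m v
      linarith
    have hl : ll N x m < v := by
      by_contra h; exact hb ((bad_iff N x hN hv hvm).2 (by omega))
    have i1 := mul_le_mul_of_nonneg_left
      (ih (by omega) (max m (v + 1)) (v + 1) (by omega) (le_max_right _ _) (by omega)) (bu0 v)
    have i2 : (1 - besselUp v) * UU N x (max m (v - 1)) (v - 1) ≤ (1 - besselUp v) *
        (uu (BB N x) besselUp j (max m (v - 1)) (v - 1) +
          (((N : ℝ) + 1) ^ 2 - ((v - 1 : ℕ) : ℝ) ^ 2 + ((H : ℝ) - j)) / H) := by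
      rcases Nat.lt_or_ge 1 v with h | h
      · exact mul_le_mul_of_nonneg_left (ih (by omega) _ _ (by omega) (le_max_right _ _) (by omega))
          (sub_nonneg.2 (bu1 v))
      · obtain rfl : v = 1 := by omega
        have : besselUp 1 = 1 := by norm_num [besselUp]
        simp [this]
    rw [UU_up N x hv hvm hmN] at i1
    rw [UU_down N x hvm hmN] at i2
    rw [UU, if_pos hmN, ← ss_harm N x hv hl]
    have drift : besselUp v * ((((N : ℝ) + 1) ^ 2 - ((v + 1 : ℕ) : ℝ) ^ 2 + ((H : ℝ) - j)) / H) +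
        (1 - besselUp v) * ((((N : ℝ) + 1) ^ 2 - ((v - 1 : ℕ) : ℝ) ^ 2 + ((H : ℝ) - j)) / H) ≤
        (((N : ℝ) + 1) ^ 2 - (v : ℝ) ^ 2 + ((H : ℝ) - (j + 1 : ℕ))) / H := by
      rw [← mul_div_assoc, ← mul_div_assoc, ← add_div]
      apply div_le_div_of_nonneg_right _ hH'.le
      have hv' : (0 : ℝ) < v := by exact_mod_cast hv
      have hb : besselUp v * (2 * v) = v + 1 := by
        rw [besselUp, if_neg (by omega)]; field_simp
      rw [Nat.cast_sub hv]; push_cast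
      nlinarith
    linarith

end pot

lemma qP (r : ℝ) (hr0 : 0 < r) (hr1 : r < 1) :
    (∀ k, besselUp k ≤ besselUpP r k) ∧ (∀ k, besselUpP r k ≤ 1) ∧ besselUpP r 1 = 1 := by
  have hlt : ∀ k : ℕ, k ≠ 0 → r ^ k < 1 := fun k hk => pow_lt_one₀ hr0.le hr1 hk
  refine ⟨fun k => ?_, fun k => ?_, ?_⟩
  · unfold besselUp besselUpP
    split_ifs with hk
    · exact le_rfl
    have h1 := hlt k hk
    have hk' : (0 : ℝ) < k := by exact_mod_cast Nat.pos_of_ne_zero hk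
    rw [div_le_div_iff₀ (by positivity) (mul_pos (by linarith) (by linarith))]
    -- by induction
    have main : ∀ k : ℕ, ((k : ℝ) + 1) * ((1 + r) * (1 - r ^ k)) ≤ (1 - r ^ (k + 1)) * (2 * k) := by
      intro k
      have hA : ∀ k : ℕ, 0 ≤ (k : ℝ) * r ^ (k + 1) - (k + 1) * r ^ k + 1 := by
        intro k
        induction k with
        | zero => simp
        | succ k ih =>
          have : (0 : ℝ) ≤ (k + 1) * r ^ k * (1 - r) ^ 2 := by positivity
          push_cast
          have hp := pow_nonneg hr0.le k
          have e1 : r ^ (k + 1) = r ^ k * r := pow_succ _ _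
          have e2 : r ^ (k + 1 + 1) = r ^ k * r * r := by rw [pow_succ, pow_succ]
          rw [e1] at ih
          rw [e2, e1]
          nlinarith
      induction k with
      | zero => simp
      | succ k ih =>
        have h := mul_nonneg (hA k) (sub_nonneg.2 hr1.le)
        push_cast at h ⊢
        have e1 : r ^ (k + 1) = r ^ k * r := pow_succ _ _
        have e2 : r ^ (k + 1 + 1) = r ^ k * r * r := by rw [pow_succ, pow_succ]
        rw [e1] at ih h
        rw [e2, e1]
        nlinarith
    exact main k
  · unfold besselUpP
    split_ifs with hk
    · exact le_rfl
    have h1 := hlt k hk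
    rw [div_le_one (mul_pos (by linarith) (by linarith))]
    obtain ⟨j, rfl⟩ : ∃ j, k = j + 1 := ⟨k - 1, by omega⟩
    have : r ^ (j + 1) ≤ r := pow_le_of_le_one hr0.le hr1.le (by omega)
    have e2 : r ^ (j + 1 + 1) = r ^ (j + 1) * r := pow_succ _ _
    rw [e2]
    nlinarith
  · have h1 : (1 - r) ≠ 0 := by linarith
    have h2 : (1 + r) ≠ 0 := by linarith
    simp only [besselUpP]
    norm_num
    field_simp
    ring

end Aux15

open Aux15 in
/-- `M_N(W*_p)` is stochastically dominated by `M_N(W*_{1/2})`. -/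
theorem stmt_15
    (p : ℝ) (hp : p ∈ Set.Ioo (1 / 2 : ℝ) 1) (r : ℝ) (hr : r = (1 - p) / p)
    (N : ℕ) (hN : 2 ≤ N)
    (Ω₁ : Type) [MeasurableSpace Ω₁] (μ₁ : Measure Ω₁) [IsProbabilityMeasure μ₁]
    (V₁ : ℕ → Ω₁ → ℕ) (hmeas₁ : ∀ n, Measurable (V₁ n))
    (hstart₁ : μ₁ {ω | V₁ 0 ω = 0} = 1)
    (hupstep₁ : ∀ (n : ℕ) (v : ℕ → ℕ),
      μ₁ ({ω | ∀ j ≤ n, V₁ j ω = v j} ∩ {ω | V₁ (n + 1) ω = v n + 1}) =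
        ENNReal.ofReal (besselUpP r (v n)) * μ₁ {ω | ∀ j ≤ n, V₁ j ω = v j})
    (hdownstep₁ : ∀ (n : ℕ) (v : ℕ → ℕ),
      μ₁ ({ω | ∀ j ≤ n, V₁ j ω = v j} ∩ {ω | V₁ (n + 1) ω = v n - 1}) =
        ENNReal.ofReal (1 - besselUpP r (v n)) * μ₁ {ω | ∀ j ≤ n, V₁ j ω = v j})
    (Ω₂ : Type) [MeasurableSpace Ω₂] (μ₂ : Measure Ω₂) [IsProbabilityMeasure μ₂]
    (V₂ : ℕ → Ω₂ → ℕ) (hmeas₂ : ∀ n, Measurable (V₂ n))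
    (hstart₂ : μ₂ {ω | V₂ 0 ω = 0} = 1)
    (hupstep₂ : ∀ (n : ℕ) (v : ℕ → ℕ),
      μ₂ ({ω | ∀ j ≤ n, V₂ j ω = v j} ∩ {ω | V₂ (n + 1) ω = v n + 1}) =
        ENNReal.ofReal (besselUp (v n)) * μ₂ {ω | ∀ j ≤ n, V₂ j ω = v j})
    (hdownstep₂ : ∀ (n : ℕ) (v : ℕ → ℕ),
      μ₂ ({ω | ∀ j ≤ n, V₂ j ω = v j} ∩ {ω | V₂ (n + 1) ω = v n - 1}) =
        ENNReal.ofReal (1 - besselUp (v n)) * μ₂ {ω | ∀ j ≤ n, V₂ j ω = v j}) :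
    ∀ x : ℝ, μ₁ {ω | x < MN N V₁ ω} ≤ μ₂ {ω | x < MN N V₂ ω} := by
  intro x
  have hp0 : 0 < p := by linarith [hp.1]
  have hr0 : 0 < r := by rw [hr]; exact div_pos (by linarith [hp.2]) hp0
  have hr1 : r < 1 := by rw [hr, div_lt_one hp0]; linarith [hp.1]
  obtain ⟨hq, hq1, hone⟩ := qP r hr0 hr1
  have hq0 : ∀ k, 0 ≤ besselUpP r k := fun k => (bu0 k).trans (hq k)
  rcases lt_or_ge x 0 with hx | hx
  · have hall : {ω | x < MN N V₂ ω} = univ := by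
      refine eq_univ_of_forall fun ω => lt_of_lt_of_le hx ?_
      exact MN_nonneg N hN V₂ ω
    rw [hall, measure_univ]
    exact prob_le_one
  have good₁ := ae_good μ₁ V₁ _ hmeas₁ hq0 hq1 hstart₁ hupstep₁ hdownstep₁
  have good₂ := ae_good μ₂ V₂ _ hmeas₂ bu0 bu1 hstart₂ hupstep₂ hdownstep₂
  have m₁ := measFF μ₁ V₁ _ hmeas₁ hq0 hq1 hstart₁ hupstep₁ hdownstep₁ (BB N x)
  have m₂ := measFF μ₂ V₂ _ hmeas₂ bu0 bu1 hstart₂ hupstep₂ hdownstep₂ (BB N x)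
  have hb00 : ¬ BB N x 0 0 := fun h => absurd h.1 (by norm_num)
  have s1 : ∀ j, uu (BB N x) (besselUpP r) j 0 0 ≤ UU N x 1 1 := by
    intro j
    cases j with
    | zero => rw [uu, if_neg hb00]; exact UU_nonneg N x le_rfl le_rfl
    | succ j =>
      have h := up_le N x hN _ hq0 hq1 hone hq j 1 1 le_rfl le_rfl
      have e : besselUpP r 0 = 1 := by simp [besselUpP]
      rw [uu, if_neg hb00, e]; simpa using h
  have s2 : ∀ H : ℕ, 1 ≤ H → UU N x 1 1 ≤ uu (BB N x) besselUp (H + 1) 0 0 + ((N : ℝ) + 1) ^ 2 / H := by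
    intro H hH
    have h := low_le N x hN H hH H le_rfl 1 1 le_rfl le_rfl (by omega)
    have e : besselUp 0 = 1 := by simp [besselUp]
    rw [uu, if_neg hb00, e]
    have hH' : (0 : ℝ) < H := by exact_mod_cast hH
    have : (((N : ℝ) + 1) ^ 2 - ((1 : ℕ) : ℝ) ^ 2 + ((H : ℝ) - H)) / H ≤ ((N : ℝ) + 1) ^ 2 / H := by
      apply div_le_div_of_nonneg_right _ hH'.le
      norm_num
    simp only [zero_add, one_mul, sub_self, zero_mul, add_zero, Nat.zero_max]
    linarith
  have up : μ₁ {ω | x < MN N V₁ ω} ≤ ENNReal.ofReal (UU N x 1 1) := by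
    have hmono : Monotone (fun j => FF V₁ (BB N x) 0 j) := by
      rintro a b hab ω ⟨i, hi, h⟩
      exact ⟨i, hi.trans hab, h⟩
    have hle : μ₁ {ω | x < MN N V₁ ω} ≤ μ₁ (⋃ j, FF V₁ (BB N x) 0 j) := by
      apply measure_mono_ae
      filter_upwards [good₁] with ω hω h
      obtain ⟨n, hn⟩ := (MN_iff N hN V₁ ω hω.1 hω.2 x hx).1 h
      refine mem_iUnion.2 ⟨n, n, le_rfl, ?_⟩
      simpa using hn
    refine hle.trans ?_
    rw [hmono.measure_iUnion]
    refine iSup_le fun j => ?_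
    rw [m₁]
    exact ENNReal.ofReal_le_ofReal (s1 j)
  have low : ∀ j, ENNReal.ofReal (uu (BB N x) besselUp j 0 0) ≤ μ₂ {ω | x < MN N V₂ ω} := by
    intro j
    rw [← m₂]
    apply measure_mono_ae
    filter_upwards [good₂] with ω hω h
    obtain ⟨i, hi, h⟩ := h
    refine (MN_iff N hN V₂ ω hω.1 hω.2 x hx).2 ⟨i, ?_⟩
    simpa using h
  refine up.trans ?_
  have hfin : μ₂ {ω | x < MN N V₂ ω} ≠ ⊤ := measure_ne_top _ _
  rw [ENNReal.ofReal_le_iff_le_toReal hfin]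
  have low' : ∀ H : ℕ, 1 ≤ H →
      UU N x 1 1 ≤ (μ₂ {ω | x < MN N V₂ ω}).toReal + ((N : ℝ) + 1) ^ 2 / H := by
    intro H hH
    have := (ENNReal.ofReal_le_iff_le_toReal hfin).1 (low (H + 1))
    linarith [s2 H hH]
  have ht : Tendsto (fun H : ℕ => (μ₂ {ω | x < MN N V₂ ω}).toReal + ((N : ℝ) + 1) ^ 2 / H) atTop
      (nhds ((μ₂ {ω | x < MN N V₂ ω}).toReal + 0)) :=
    tendsto_const_nhds.add (tendsto_const_div_atTop_nhds_zero_nat _)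
  rw [add_zero] at ht
  exact ge_of_tendsto ht (eventually_atTop.2 ⟨1, low'⟩)
end

section
/- Let M ≥ 1, δ ≥ 0, and let w : ℕ → ℤ be a nearest-neighbour path (|w(n+1) − w(n)| = 1 for all n) with w(n) ≥ 1 for 1 ≤ n ≤ M, such that | log w(n) − (1/2) log n | ≤ δ for all 1 ≤ n ≤ M. Let k ≥ 1 and let τ_k := inf{n ≥ 0 : w(n) = k} and τ_{k+1} := inf{n ≥ 0 : w(n) = k+1} be the first hitting times, and suppose 1 ≤ τ_k ≤ j < τ_{k+1} ≤ M. Then w(j) ≤ k and | log k − log w(j) | ≤ 2δ. -/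
/-- First hitting time of level `m` by a deterministic path `w`, `⊤` if never hit. -/
noncomputable def pathHit (w : ℕ → ℤ) (m : ℤ) : ℕ∞ :=
  ⨅ (n : ℕ) (_ : w n = m), (n : ℕ∞)

/-- Deterministic fluctuation lemma: for a nearest-neighbour path `w` positive on
`[1,M]` with `|log w(n) - ½ log n| ≤ δ` there, and `1 ≤ τ_k ≤ j < τ_{k+1} ≤ M`,
one has `w(j) ≤ k` and `|log k - log w(j)| ≤ 2δ`. -/
theorem stmt_16
    (M : ℕ) (hM : 1 ≤ M) (δ : ℝ) (hδ : 0 ≤ δ)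
    (w : ℕ → ℤ) (hstep : ∀ n : ℕ, |w (n + 1) - w n| = 1)
    (hpos : ∀ n : ℕ, 1 ≤ n → n ≤ M → 1 ≤ w n)
    (hlog : ∀ n : ℕ, 1 ≤ n → n ≤ M →
      |Real.log (w n) - (1 / 2) * Real.log n| ≤ δ)
    (k : ℕ) (hk : 1 ≤ k) (j : ℕ)
    (h1 : 1 ≤ pathHit w (k : ℤ))
    (h2 : pathHit w (k : ℤ) ≤ (j : ℕ∞))
    (h3 : (j : ℕ∞) < pathHit w ((k : ℤ) + 1))
    (h4 : pathHit w ((k : ℤ) + 1) ≤ (M : ℕ∞)) :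
    w j ≤ (k : ℤ) ∧ |Real.log k - Real.log (w j)| ≤ 2 * δ := by
  have hle : ∀ (m : ℤ) (n : ℕ), w n = m → pathHit w m ≤ (n : ℕ∞) := by
    intro m n h
    exact iInf₂_le n h
  obtain ⟨t, htj, htk⟩ : ∃ t : ℕ, t ≤ j ∧ w t = k := by
    by_contra hcon
    push Not at hcon
    have h5 : ((j + 1 : ℕ) : ℕ∞) ≤ pathHit w (k : ℤ) := by
      refine le_iInf₂ fun n hn => ?_
      have : ¬ n ≤ j := fun h => hcon n h hn
      exact_mod_cast (by omega : j + 1 ≤ n)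
    have h6 : j + 1 ≤ j := by exact_mod_cast h5.trans h2
    omega
  have ht1 : 1 ≤ t := by exact_mod_cast h1.trans (hle _ t htk)
  have hjM : j < M := by exact_mod_cast h3.trans_le h4
  have hne : ∀ n : ℕ, n ≤ j → w n ≠ (k : ℤ) + 1 := by
    intro n hn h
    have h7 : j < n := by exact_mod_cast h3.trans_le (hle _ n h)
    omega
  have hwle : ∀ n : ℕ, t ≤ n → n ≤ j → w n ≤ (k : ℤ) := by
    intro n hn
    induction n, hn using Nat.le_induction with
    | base => intro _; exact htk.le
    | succ n hn ih =>
      intro hj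
      have a := ih (by omega)
      have b := hne (n + 1) hj
      have c := (abs_le.mp (hstep n).le).2
      omega
  have hwj := hwle j htj le_rfl
  refine ⟨hwj, ?_⟩
  have p1 := hpos j (by omega) hjM.le
  have l1 := abs_le.mp (hlog j (by omega) hjM.le)
  have l2 := abs_le.mp (hlog t ht1 (by omega))
  rw [htk] at l2
  have e1 : Real.log (w j) ≤ Real.log k :=
    Real.log_le_log (by exact_mod_cast p1) (by exact_mod_cast hwj)
  have e2 : Real.log t ≤ Real.log j :=
    Real.log_le_log (by exact_mod_cast ht1) (by exact_mod_cast htj)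
  push_cast at l2
  rw [abs_le]
  constructor <;> linarith [l1.1, l1.2, l2.1, l2.2]
end
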